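/- Let X be a nonempty compact metric space and A : X → ℝ a continuous function, with minimum value m = min_X A attained on the set S = A⁻¹(m). Let C₀ be a connected component of S, and for ε > 0 let U_ε denote the connected component of the open sublevel set { x ∈ X | A(x) < m + ε } that contains C₀ (this component is well defined since C₀ is connected and contained in the sublevel set). Then the open sets U_ε, ε > 0, form a fundamental system of neighborhoods of C₀: for every open set U ⊆ X with C₀ ⊆ U there exists ε > 0 such that U_ε ⊆ U. -/

import Mathlib

open Set in
/-- A directed intersection of closed preconnected sets in a compact Hausdorff space is
preconnected. -/
theorem IsPreconnected.iInter_of_directed {X ι : Type*} [TopologicalSpace X] [CompactSpace X]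
    [T2Space X] [Nonempty ι] {K : ι → Set X} (hdir : Directed (· ⊇ ·) K)
    (hclosed : ∀ i, IsClosed (K i)) (hconn : ∀ i, IsPreconnected (K i)) :
    IsPreconnected (⋂ i, K i) := by
  rw [isPreconnected_iff_subset_of_fully_disjoint_closed (isClosed_iInter hclosed)]
  intro u v hu hv huv hdisj
  obtain ⟨u', v', hu', hv', huu', hvv', hdisj'⟩ := normal_separation hu hv hdisj
  obtain ⟨i, hi⟩ := exists_subset_nhds_of_compactSpace hdir hclosed
    (U := u' ∪ v') fun x hx =>
      (hu'.union hv').mem_nhds ((union_subset_union huu' hvv') (huv hx))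
  have hsub : ⋂ i, K i ⊆ K i := iInter_subset K i
  refine ((hconn i).subset_or_subset hu' hv' hdisj' hi).imp (fun h x hx => ?_) fun h x hx => ?_
  · exact (huv hx).resolve_right fun hxv =>
      disjoint_left.mp hdisj' (h (hsub hx)) (hvv' hxv)
  · exact (huv hx).resolve_left fun hxu =>
      disjoint_left.mp hdisj' (huu' hxu) (h (hsub hx))


/-- For a continuous function `A` on a nonempty compact metric space with
minimum value `m` attained on `S`, and a connected component `C₀` of `S` (the component
of a point `x₀ ∈ S`), the connected components `U_ε` of the sublevel sets `{A < m + ε}`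
containing `C₀` form a fundamental system of neighborhoods of `C₀`. -/
theorem sublevel_components_fundamental_system
    {X : Type*} [MetricSpace X] [CompactSpace X] [Nonempty X]
    (A : X → ℝ) (hA : Continuous A)
    (m : ℝ) (hm : IsLeast (Set.range A) m)
    (S : Set X) (hS : S = A ⁻¹' {m})
    (x₀ : X) (hx₀ : x₀ ∈ S)
    (C₀ : Set X) (hC₀ : C₀ = connectedComponentIn S x₀)
    (U : Set X) (hU : IsOpen U) (hCU : C₀ ⊆ U) :
    ∃ ε > (0 : ℝ), connectedComponentIn {x | A x < m + ε} x₀ ⊆ U := by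
  subst hS hC₀
  let V : ℕ → Set X := fun n => {x | A x < m + 1 / ((n : ℝ) + 1)}
  let K : ℕ → Set X := fun n => closure (connectedComponentIn (V n) x₀)
  have hx₀V (n : ℕ) : x₀ ∈ V n := by
    have hx : A x₀ = m := hx₀
    have : (0 : ℝ) < 1 / ((n : ℝ) + 1) := by positivity
    change A x₀ < _
    linarith
  have hK : Antitone K := fun i j hij =>
    closure_mono <| connectedComponentIn_mono x₀ fun x (hx : A x < _) => by
      have := Nat.one_div_le_one_div (α := ℝ) hij
      change A x < _
      linarith
  have hle (n : ℕ) (x : X) (hx : x ∈ K n) : A x ≤ m + 1 / ((n : ℝ) + 1) :=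
    closure_minimal (fun y hy => le_of_lt (connectedComponentIn_subset (V n) x₀ hy))
      (isClosed_le hA continuous_const) hx
  have hKS : ⋂ n, K n ⊆ A ⁻¹' {m} := fun x hx => by
    refine le_antisymm (ge_of_tendsto' (f := fun n : ℕ => m + 1 / ((n : ℝ) + 1))
      (x := Filter.atTop) ?_ fun n => hle n x (Set.mem_iInter.mp hx n)) (hm.2 ⟨x, rfl⟩)
    simpa using tendsto_one_div_add_atTop_nhds_zero_nat.const_add m
  have hconn : IsPreconnected (⋂ n, K n) :=
    IsPreconnected.iInter_of_directed hK.directed_ge (fun _ => isClosed_closure)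
      fun _ => isPreconnected_connectedComponentIn.closure
  have hKU : ⋂ n, K n ⊆ U := (hconn.subset_connectedComponentIn
    (Set.mem_iInter.mpr fun n => subset_closure (mem_connectedComponentIn (hx₀V n)))
    hKS).trans hCU
  obtain ⟨n, hn⟩ := exists_subset_nhds_of_compactSpace hK.directed_ge
    (fun _ => isClosed_closure) fun x hx => hU.mem_nhds (hKU hx)
  exact ⟨1 / ((n : ℝ) + 1), by positivity, subset_closure.trans hn⟩
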